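/- arXiv:1607.05874 — 2 statements merged into one kernel-verified Lean document; each statement's English description precedes it below -/
import Mathlib

section
/- Let (X_n)_{n∈ℤ} be a stationary, invertible functional linear process in L²_H with white noise (ε_n)_{n∈ℤ} such that all eigenvalues of the covariance operator C_ε are positive, and assume Σ_{j=0}^∞ ‖ψ_j‖_L < ∞ so that the spectral density operator F_X[ω] is well defined. Then for every ω ∈ (−π,π] the spectral density operator F_X[ω] has only positive eigenvalues; in particular F_X[ω](v) ≠ 0 for every nonzero v. -/
open MeasureTheory Filter
open scoped RealInnerProductSpace Topology

noncomputable section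

namespace FLP

variable {Ω : Type*} [MeasurableSpace Ω]
variable {H : Type*} [NormedAddCommGroup H] [InnerProductSpace ℝ H] [CompleteSpace H]

/-- The rank-one operator `x ⊗ y : z ↦ ⟪x, z⟫ • y`. -/
def outer (x y : H) : H →L[ℝ] H := (innerSL ℝ x).smulRight y

/-- The cross covariance operator `C_{X,Y} = E[X ⊗ Y]`, i.e. `y ↦ E[⟪X, y⟫ Y]`. -/
def crossCov (μ : Measure Ω) (X Y : Ω → H) : H →L[ℝ] H :=
  ∫ ω, outer (X ω) (Y ω) ∂μ

/-- The covariance operator `C_X = E[X ⊗ X]`. -/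
def covOp (μ : Measure Ω) (X : Ω → H) : H →L[ℝ] H := crossCov μ X X

/-- White noise in `L²_H`. -/
def IsWhiteNoise (μ : Measure Ω) (ε : ℤ → Ω → H) : Prop :=
  (∀ n, MemLp (ε n) 2 μ) ∧
  (∀ n, ∫ ω, ε n ω ∂μ = 0) ∧
  (0 < ∫ ω, ‖ε 0 ω‖ ^ 2 ∂μ) ∧
  (∀ n, covOp μ (ε n) = covOp μ (ε 0)) ∧
  (∀ n m : ℤ, n ≠ m → crossCov μ (ε n) (ε m) = 0)

/-- Weak stationarity: zero mean and cross covariances depending only on the lag. -/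
def IsWeaklyStationary (μ : Measure Ω) (X : ℤ → Ω → H) : Prop :=
  (∀ n, MemLp (X n) 2 μ) ∧
  (∀ n, ∫ ω, X n ω ∂μ = 0) ∧
  (∀ n m k : ℤ, crossCov μ (X (n + k)) (X (m + k)) = crossCov μ (X n) (X m))

/-- A functional linear process `X_n = Σ_{j≥0} ψ_j ε_{n-j}` (series converging in `L²_H`). -/
structure IsFLP (μ : Measure Ω) (X ε : ℤ → Ω → H) (ψ : ℕ → H →L[ℝ] H) : Prop where
  whiteNoise : IsWhiteNoise μ ε
  psi_zero : ψ 0 = ContinuousLinearMap.id ℝ H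
  summable_sq : Summable fun j => ‖ψ j‖ ^ 2
  memLp : ∀ n, MemLp (X n) 2 μ
  repr : ∀ n : ℤ, Tendsto
    (fun N : ℕ => ∫ ω, ‖X n ω - ∑ j ∈ Finset.range N, ψ j (ε (n - j) ω)‖ ^ 2 ∂μ)
    atTop (𝓝 0)

/-- Invertibility: `X_n = ε_n + Σ_{j≥1} π_j X_{n-j}` (series converging in `L²_H`),
with `Σ_{j≥1} ‖π_j‖ < ∞`.  (`piOp 0` is irrelevant.) -/
def IsInvertible (μ : Measure Ω) (X ε : ℤ → Ω → H) (piOp : ℕ → H →L[ℝ] H) : Prop :=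
  (Summable fun j : ℕ => ‖piOp (j + 1)‖) ∧
  ∀ n : ℤ, Tendsto
    (fun N : ℕ => ∫ ω,
      ‖X n ω - ε n ω - ∑ j ∈ Finset.range N, piOp (j + 1) (X (n - (j + 1)) ω)‖ ^ 2 ∂μ)
    atTop (𝓝 0)

/-- The orthogonal projection onto `A_D = span{ν_0, …, ν_{D-1}}` (for `ν` orthonormal). -/
def proj (ν : ℕ → H) (D : ℕ) : H →L[ℝ] H :=
  ∑ i ∈ Finset.range D, (innerSL ℝ (ν i)).smulRight (ν i)

/-- Finite linear combinations `Σ l_i f_i` with bounded operators `l_i` and `f_i ∈ F`. -/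
def linComb (F : Set (Ω → H)) : Set (Ω → H) :=
  {g | ∃ (k : ℕ) (l : Fin k → H →L[ℝ] H) (f : Fin k → Ω → H),
      (∀ i, f i ∈ F) ∧ g = fun ω => ∑ i, l i (f i ω)}

/-- `Xhat` is the best linear predictor of `X` based on `F`, i.e. the orthogonal projection
in `L²_H` of `X` onto the `L`-closed subspace `LCS(F)` generated by `F`:
`Xhat` is square integrable, lies in the `L²`-closure of the linear combinations of
elements of `F`, and `X - Xhat` is orthogonal to them. -/
def IsBLP (μ : Measure Ω) (F : Set (Ω → H)) (X Xhat : Ω → H) : Prop :=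
  MemLp Xhat 2 μ ∧
  (∀ δ : ℝ, 0 < δ → ∃ g ∈ linComb F, ∫ ω, ‖Xhat ω - g ω‖ ^ 2 ∂μ < δ) ∧
  (∀ g ∈ linComb F, ∫ ω, ⟪X ω - Xhat ω, g ω⟫ ∂μ = 0)

/-- The trace of an operator along an orthonormal basis `ν`; for the self-adjoint
non-negative operators appearing below this is the nuclear norm `‖·‖_N`
(cf. the definition of `‖A‖_N = Σ_j ⟨A e_j, e_j⟩` in the paper). -/
def traceAlong (ν : ℕ → H) (T : H →L[ℝ] H) : ℝ := ∑' i : ℕ, ⟪T (ν i), ν i⟫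

/-- The nuclear norm of an operator: `sup Σ_i |⟨T e_i, f_i⟩|` over orthonormal
sequences `(e_i)`, `(f_i)`. -/
def nuclearNorm (T : H →L[ℝ] H) : ℝ :=
  ⨆ p : {p : (ℕ → H) × (ℕ → H) // Orthonormal ℝ p.1 ∧ Orthonormal ℝ p.2},
    ∑' i : ℕ, |⟪T (p.1.1 i), p.1.2 i⟫|


/-- Real part of `F_X[ω](x + iy)`, where
`F_X[ω] = (1/2π) Σ_{h∈ℤ} C_{X;h} e^{−ihω}` is the spectral density operator acting on
the complexification of `H` (a complex vector is encoded as a pair `(x, y) = x + iy`). -/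
def specRe (μ : Measure Ω) (X : ℤ → Ω → H) (ω : ℝ) (x y : H) : H :=
  (1 / (2 * Real.pi)) •
    ∑' h : ℤ, (Real.cos (h * ω) • crossCov μ (X 0) (X h) x +
      Real.sin (h * ω) • crossCov μ (X 0) (X h) y)

/-- Imaginary part of `F_X[ω](x + iy)`; see `specRe`. -/
def specIm (μ : Measure Ω) (X : ℤ → Ω → H) (ω : ℝ) (x y : H) : H :=
  (1 / (2 * Real.pi)) •
    ∑' h : ℤ, (Real.cos (h * ω) • crossCov μ (X 0) (X h) y -
      Real.sin (h * ω) • crossCov μ (X 0) (X h) x)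

theorem outer_integrable {μ : Measure Ω} {F G : Ω → H} (hF : MemLp F 2 μ) (hG : MemLp G 2 μ) :
    Integrable (fun ω => outer (F ω) (G ω)) μ := by
  rw [← memLp_one_iff_integrable]
  refine MemLp.of_bilin (p := 2) (q := 2) (fun x y : H => outer x y) 1 hF hG ?_ ?_
  · have h1 : Continuous fun p : H × H => outer p.1 p.2 := by
      have : (fun p : H × H => outer p.1 p.2) =
          fun p : H × H => ContinuousLinearMap.smulRightL ℝ H H (innerSL ℝ p.1) p.2 := by
        ext p; rfl
      rw [this]
      fun_prop
    exact h1.comp_aestronglyMeasurable (hF.1.prodMk hG.1)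
  · refine Eventually.of_forall fun ω => ?_
    simp only [outer, one_mul]
    rw [← NNReal.coe_le_coe]
    simp

theorem crossCov_apply {μ : Measure Ω} {F G : Ω → H} (hF : MemLp F 2 μ) (hG : MemLp G 2 μ)
    (x y : H) : ⟪crossCov μ F G x, y⟫ = ∫ ω, ⟪F ω, x⟫ * ⟪G ω, y⟫ ∂μ := by
  have hi := outer_integrable hF hG
  rw [crossCov, ContinuousLinearMap.integral_apply hi, real_inner_comm]
  have := integral_inner (𝕜 := ℝ) (hi.apply_continuousLinearMap x) y
  rw [← this]
  congr 1
  ext ω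
  simp [outer, inner_smul_right, real_inner_comm]

theorem norm_toLp_sq {E : Type*} [NormedAddCommGroup E] [InnerProductSpace ℝ E]
    {μ : Measure Ω} {F : Ω → E} (hF : MemLp F 2 μ) :
    ‖hF.toLp F‖ ^ 2 = ∫ ω, ‖F ω‖ ^ 2 ∂μ := by
  rw [← real_inner_self_eq_norm_sq, L2.inner_def]
  apply integral_congr_ae
  filter_upwards [hF.coeFn_toLp] with ω h
  rw [h, real_inner_self_eq_norm_sq]

theorem tendsto_toLp {μ : Measure Ω} {F : ℕ → Ω → H} {G : Ω → H}
    (hF : ∀ N, MemLp (F N) 2 μ) (hG : MemLp G 2 μ)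
    (h : Tendsto (fun N => ∫ ω, ‖G ω - F N ω‖ ^ 2 ∂μ) atTop (𝓝 0)) :
    Tendsto (fun N => (hF N).toLp (F N)) atTop (𝓝 (hG.toLp G)) := by
  rw [tendsto_iff_norm_sub_tendsto_zero]
  have h2 : Tendsto (fun N => √(∫ ω, ‖G ω - F N ω‖ ^ 2 ∂μ)) atTop (𝓝 0) := by
    simpa using h.sqrt
  refine h2.congr fun N => ?_
  rw [norm_sub_rev, ← MemLp.toLp_sub, Real.sqrt_eq_iff_mul_self_eq]
  · rw [← pow_two, norm_toLp_sq]; rfl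
  · positivity
  · positivity

theorem crossCov_tendsto {μ : Measure Ω} {F F' : ℕ → Ω → H} {G G' : Ω → H}
    (hF : ∀ N, MemLp (F N) 2 μ) (hG : MemLp G 2 μ)
    (hF' : ∀ N, MemLp (F' N) 2 μ) (hG' : MemLp G' 2 μ)
    (h : Tendsto (fun N => ∫ ω, ‖G ω - F N ω‖ ^ 2 ∂μ) atTop (𝓝 0))
    (h' : Tendsto (fun N => ∫ ω, ‖G' ω - F' N ω‖ ^ 2 ∂μ) atTop (𝓝 0)) (x y : H) :
    Tendsto (fun N => ⟪crossCov μ (F N) (F' N) x, y⟫) atTop (𝓝 ⟪crossCov μ G G' x, y⟫) := by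
  have key : ∀ {A B : Ω → H} (hA : MemLp A 2 μ) (hB : MemLp B 2 μ),
      ⟪crossCov μ A B x, y⟫ = ⟪(innerSL ℝ x).compLp (hA.toLp A),
        (innerSL ℝ y).compLp (hB.toLp B)⟫ := by
    intro A B hA hB
    rw [crossCov_apply hA hB, L2.inner_def]
    apply integral_congr_ae
    filter_upwards [(innerSL ℝ x).coeFn_compLp (hA.toLp A),
      (innerSL ℝ y).coeFn_compLp (hB.toLp B), hA.coeFn_toLp, hB.coeFn_toLp] with ω h1 h2 h3 h4
    rw [h1, h2, h3, h4]
    simp [real_inner_comm, mul_comm]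
  simp_rw [key (hF _) (hF' _)]
  rw [key hG hG']
  refine Tendsto.inner ?_ ?_
  · exact (((innerSL ℝ x).compLpL 2 μ).continuous.tendsto _).comp (tendsto_toLp hF hG h)
  · exact (((innerSL ℝ y).compLpL 2 μ).continuous.tendsto _).comp (tendsto_toLp hF' hG' h')

theorem memLp_sum {μ : Measure Ω} {ε : ℕ → Ω → H} (hε : ∀ n, MemLp (ε n) 2 μ)
    (ψ : ℕ → H →L[ℝ] H) (N : ℕ) :
    MemLp (fun ω => ∑ j ∈ Finset.range N, ψ j (ε j ω)) 2 μ :=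
  memLp_finsetSum (Finset.range N) (f := fun j ω => ψ j (ε j ω))
    fun j _ => (ψ j).comp_memLp' (hε j)

theorem crossCov_sum_right {μ : Measure Ω} {F : Ω → H} {ε : ℕ → Ω → H} (hF : MemLp F 2 μ)
    (hε : ∀ n, MemLp (ε n) 2 μ) (ψ : ℕ → H →L[ℝ] H) (N : ℕ) (x y : H) :
    ⟪crossCov μ F (fun ω => ∑ j ∈ Finset.range N, ψ j (ε j ω)) x, y⟫ =
      ∑ j ∈ Finset.range N, ⟪ψ j (crossCov μ F (ε j) x), y⟫ := by
  rw [crossCov_apply hF (memLp_sum hε ψ N)]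
  have : ∀ j, ⟪ψ j (crossCov μ F (ε j) x), y⟫ = ∫ ω, ⟪F ω, x⟫ * ⟪ψ j (ε j ω), y⟫ ∂μ := by
    intro j
    rw [← ContinuousLinearMap.adjoint_inner_right, crossCov_apply hF (hε j)]
    simp_rw [ContinuousLinearMap.adjoint_inner_right]
  simp_rw [this]
  rw [← integral_finsetSum]
  · simp_rw [sum_inner, Finset.mul_sum]
  · intro j _
    exact (hF.inner_const x).integrable_mul (((ψ j).comp_memLp' (hε j)).inner_const y)

theorem crossCov_symm {μ : Measure Ω} {F G : Ω → H} (hF : MemLp F 2 μ) (hG : MemLp G 2 μ)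
    (x y : H) : ⟪crossCov μ F G x, y⟫ = ⟪crossCov μ G F y, x⟫ := by
  rw [crossCov_apply hF hG, crossCov_apply hG hF]
  simp_rw [mul_comm]

theorem tendsto_const_L2 {μ : Measure Ω} (F : Ω → H) :
    Tendsto (fun _ : ℕ => ∫ ω, ‖F ω - F ω‖ ^ 2 ∂μ) atTop (𝓝 0) := by
  simp

/-- Extension of `ψ` by zero to the integers. -/
def extZ (ψ : ℕ → H →L[ℝ] H) (j : ℤ) : H →L[ℝ] H := if 0 ≤ j then ψ j.toNat else 0

theorem extZ_natCast (ψ : ℕ → H →L[ℝ] H) (j : ℕ) : extZ ψ (j : ℤ) = ψ j := by simp [extZ]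

theorem crossCov_eps_X {μ : Measure Ω} {X ε : ℤ → Ω → H} {ψ : ℕ → H →L[ℝ] H}
    (hFLP : IsFLP μ X ε ψ) (p n : ℤ) (x : H) :
    crossCov μ (ε p) (X n) x = extZ ψ (n - p) (covOp μ (ε 0) x) := by
  obtain ⟨hε, -, -, hC, hC0⟩ := hFLP.whiteNoise
  refine ext_inner_right ℝ fun y => ?_
  have h1 := crossCov_tendsto (fun _ => hε p) (hε p)
    (fun N => memLp_sum (fun j : ℕ => hε (n - j)) ψ N) (hFLP.memLp n)
    (tendsto_const_L2 _) (hFLP.repr n) x y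
  refine tendsto_nhds_unique h1 ?_
  refine tendsto_const_nhds.congr' ?_
  filter_upwards [eventually_gt_atTop (n - p).toNat] with N hN
  rw [crossCov_sum_right (hε p) (fun j : ℕ => hε (n - j))]
  by_cases hp : 0 ≤ n - p
  · rw [Finset.sum_eq_single (n - p).toNat]
    · have : n - ((n - p).toNat : ℤ) = p := by omega
      rw [this, extZ, if_pos hp, ← hC p, covOp]
    · intro j _ hj
      rw [hC0 _ _ (by omega)]
      simp
    · intro h
      simp at h
      omega
  · rw [Finset.sum_eq_zero]
    · rw [extZ, if_neg hp]; simp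
    · intro j _
      rw [hC0 _ _ (by omega)]
      simp

theorem C_symm {μ : Measure Ω} {F : Ω → H} (hF : MemLp F 2 μ) (x y : H) :
    ⟪covOp μ F x, y⟫ = ⟪x, covOp μ F y⟫ := by
  rw [real_inner_comm _ x]
  exact crossCov_symm hF hF x y

theorem C_pos {μ : Measure Ω} {F : Ω → H} (hF : MemLp F 2 μ)
    (hCε : ∀ (c : ℝ) (v : H), v ≠ 0 → covOp μ F v = c • v → 0 < c) (v : H) (hv : v ≠ 0) :
    0 < ⟪covOp μ F v, v⟫ := by
  have h0 : ⟪covOp μ F v, v⟫ = ∫ ω, ⟪F ω, v⟫ * ⟪F ω, v⟫ ∂μ := crossCov_apply hF hF v v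
  have hnn : 0 ≤ ⟪covOp μ F v, v⟫ := by
    rw [h0]
    exact integral_nonneg fun ω => mul_self_nonneg _
  refine lt_of_le_of_ne hnn fun h => ?_
  rw [h0] at h
  have h2 := (integral_eq_zero_iff_of_nonneg (fun ω => mul_self_nonneg _)
    ((hF.inner_const v).integrable_mul (hF.inner_const v))).1 h.symm
  have h3 : covOp μ F v = (0 : ℝ) • v := by
    refine ext_inner_right ℝ fun y => ?_
    rw [zero_smul, inner_zero_left, covOp, crossCov_apply hF hF v y]
    rw [integral_eq_zero_of_ae]
    filter_upwards [h2] with ω hω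
    have : ⟪F ω, v⟫ = 0 := by simpa using hω
    simp [this]
  exact lt_irrefl _ (hCε 0 v hv h3)

theorem eq_of_comp_C {C S T : H →L[ℝ] H} 
    (hp : ∀ v, v ≠ 0 → 0 < ⟪C v, v⟫) (h : ∀ x, S (C x) = T (C x)) : S = T := by
  rw [← sub_eq_zero]
  set D := S - T with hD
  have hDC : ∀ x, D (C x) = 0 := fun x => by simp [hD, h x]
  have h1 : ∀ y, ContinuousLinearMap.adjoint D y = 0 := by
    intro y
    by_contra hy
    have := hp _ hy
    rw [ContinuousLinearMap.adjoint_inner_right, hDC, inner_zero_left] at this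
    exact lt_irrefl _ this
  ext x
  refine ext_inner_right ℝ fun y => ?_
  rw [← ContinuousLinearMap.adjoint_inner_right, h1]
  simp

theorem recursion {μ : Measure Ω} {X ε : ℤ → Ω → H} {ψ piOp : ℕ → H →L[ℝ] H}
    (hFLP : IsFLP μ X ε ψ) (hinv : IsInvertible μ X ε piOp)
    (hCε : ∀ (c : ℝ) (v : H), v ≠ 0 → covOp μ (ε 0) v = c • v → 0 < c) (m : ℕ) :
    ψ (m + 1) = ∑ j ∈ Finset.range (m + 1), piOp (j + 1) * ψ (m - j) := by
  obtain ⟨hε, -, -, hC, hC0⟩ := hFLP.whiteNoise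
  refine eq_of_comp_C (C_pos (hε 0) hCε) fun x => ?_
  refine ext_inner_right ℝ fun y => ?_
  have hX := hFLP.memLp
  set n : ℤ := m + 1 with hn
  have h1 := crossCov_tendsto (fun _ => hε 0) (hε 0)
    (fun N => memLp_sum (fun j : ℕ => hX (n - (j + 1))) (fun j => piOp (j + 1)) N)
    ((hX n).sub (hε n))
    (tendsto_const_L2 _) (hinv.2 n) x y
  have h2 : ⟪crossCov μ (ε 0) (X n - ε n) x, y⟫ = ⟪ψ (m + 1) (covOp μ (ε 0) x), y⟫ := by
    have e1 : ⟪crossCov μ (ε 0) (X n - ε n) x, y⟫ =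
        ⟪crossCov μ (ε 0) (X n) x, y⟫ - ⟪crossCov μ (ε 0) (ε n) x, y⟫ := by
      rw [crossCov_apply (hε 0) ((hX n).sub (hε n)), crossCov_apply (hε 0) (hX n),
        crossCov_apply (hε 0) (hε n), ← integral_sub]
      · simp [inner_sub_left, mul_sub]
      · exact ((hε 0).inner_const x).integrable_mul ((hX n).inner_const y)
      · exact ((hε 0).inner_const x).integrable_mul ((hε n).inner_const y)
    rw [e1, hC0 0 n (by omega), crossCov_eps_X hFLP]
    have : n - 0 = ((m + 1 : ℕ) : ℤ) := by push_cast; omega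
    rw [this, extZ_natCast]
    simp
  rw [h2] at h1
  refine tendsto_nhds_unique h1 ?_
  refine tendsto_const_nhds.congr' ?_
  filter_upwards [eventually_ge_atTop (m + 1)] with N hN
  rw [crossCov_sum_right (hε 0) (fun j : ℕ => hX (n - (j + 1))) (fun j => piOp (j + 1))]
  rw [← Finset.sum_subset (Finset.range_mono hN)]
  · rw [_root_.sum_apply, sum_inner]
    refine Finset.sum_congr rfl fun j hj => ?_
    rw [Finset.mem_range] at hj
    rw [crossCov_eps_X hFLP]
    have : n - (j + 1) - 0 = ((m - j : ℕ) : ℤ) := by omega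
    rw [this, extZ_natCast]
    rfl
  · intro j _ hj
    rw [Finset.mem_range] at hj
    rw [crossCov_eps_X hFLP, extZ, if_neg (by omega)]
    simp

/-- Coefficients of the inverse series. -/
def invCoef (piOp : ℕ → H →L[ℝ] H) : ℕ → H →L[ℝ] H
  | 0 => 1
  | j + 1 => -piOp (j + 1)

theorem left_inv {ψ piOp : ℕ → H →L[ℝ] H} (h0 : ψ 0 = 1)
    (h : ∀ m, ψ (m + 1) = ∑ j ∈ Finset.range (m + 1), piOp (j + 1) * ψ (m - j)) :
    PowerSeries.mk (invCoef piOp) * PowerSeries.mk ψ = 1 := by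
  ext1 n
  rw [PowerSeries.coeff_mul]
  simp only [PowerSeries.coeff_mk]
  cases n with
  | zero => simp [invCoef, h0]
  | succ m =>
    rw [Finset.Nat.sum_antidiagonal_succ]
    simp only [invCoef, one_mul, neg_mul, Finset.sum_neg_distrib]
    rw [Finset.Nat.sum_antidiagonal_eq_sum_range_succ (fun i j => piOp (i + 1) * ψ j), h m]
    simp [PowerSeries.coeff_one]

theorem right_of_left {R : Type*} [Ring R] {P A : PowerSeries R} (hP : PowerSeries.coeff 0 P = 1)
    (h : P * A = 1) : A * P = 1 := by
  rw [← sub_eq_zero]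
  set E := A * P - 1 with hE
  have hPE : P * E = 0 := by rw [hE, mul_sub, ← mul_assoc, h]; simp
  ext1 n
  induction n using Nat.strong_induction_on with
  | _ n ih =>
    have := congrArg (PowerSeries.coeff n) hPE
    rw [PowerSeries.coeff_mul] at this
    cases n with
    | zero => simpa [hP] using this
    | succ m =>
      rw [Finset.Nat.sum_antidiagonal_succ, Finset.sum_eq_zero, hP] at this
      · simpa using this
      · intro p hp
        rw [Finset.HasAntidiagonal.mem_antidiagonal] at hp
        simp only
        rw [ih p.2 (by omega)]
        simp

theorem right_inv {ψ piOp : ℕ → H →L[ℝ] H} (h0 : ψ 0 = 1)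
    (h : ∀ m, ψ (m + 1) = ∑ j ∈ Finset.range (m + 1), piOp (j + 1) * ψ (m - j)) (n : ℕ) :
    ∑ p ∈ Finset.HasAntidiagonal.antidiagonal n, ψ p.1 * invCoef piOp p.2 = if n = 0 then 1 else 0 := by
  have := congrArg (PowerSeries.coeff n) (right_of_left (R := H →L[ℝ] H)
    (P := PowerSeries.mk (invCoef piOp)) (A := PowerSeries.mk ψ) (by simp [invCoef])
    (left_inv h0 h))
  rw [PowerSeries.coeff_mul, PowerSeries.coeff_one] at this
  simpa using this

/-- `e^{iθ} T` acting on the complexification. -/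
def rotOp (θ : ℝ) (T : H →L[ℝ] H) : (H × H) →L[ℝ] (H × H) :=
  ((Real.cos θ • T) ∘L ContinuousLinearMap.fst ℝ H H
    - (Real.sin θ • T) ∘L ContinuousLinearMap.snd ℝ H H).prod
  ((Real.cos θ • T) ∘L ContinuousLinearMap.snd ℝ H H
    + (Real.sin θ • T) ∘L ContinuousLinearMap.fst ℝ H H)

theorem rotOp_apply (θ : ℝ) (T : H →L[ℝ] H) (v : H × H) :
    rotOp θ T v = (Real.cos θ • T v.1 - Real.sin θ • T v.2,
      Real.cos θ • T v.2 + Real.sin θ • T v.1) := rfl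

theorem rotOp_mul (θ φ : ℝ) (S T : H →L[ℝ] H) :
    rotOp θ S * rotOp φ T = rotOp (θ + φ) (S * T) := by
  refine ContinuousLinearMap.ext fun v => ?_
  simp only [_root_.mul_apply_eq_comp, rotOp_apply, map_add, map_sub, map_smul,
    Real.cos_add, Real.sin_add]
  ext
  · simp only; module
  · simp only; module

theorem rotOp_sum {ι : Type*} (θ : ℝ) (s : Finset ι) (T : ι → H →L[ℝ] H) :
    rotOp θ (∑ i ∈ s, T i) = ∑ i ∈ s, rotOp θ (T i) := by
  refine ContinuousLinearMap.ext fun v => ?_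
  simp only [_root_.sum_apply, rotOp_apply]
  ext
  · simp [Finset.smul_sum, Prod.fst_sum]
  · simp [Finset.smul_sum, Prod.snd_sum, Finset.sum_add_distrib]

theorem rotOp_norm (θ : ℝ) (T : H →L[ℝ] H) : ‖rotOp θ T‖ ≤ 2 * ‖T‖ := by
  have hb : ∀ (c : ℝ) (x : H) (v : H × H), |c| ≤ 1 → ‖x‖ ≤ ‖v‖ → ‖c • T x‖ ≤ ‖T‖ * ‖v‖ := by
    intro c x v hc hx
    rw [norm_smul, Real.norm_eq_abs]
    calc |c| * ‖T x‖ ≤ 1 * (‖T‖ * ‖x‖) := by gcongr; exact T.le_opNorm x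
      _ ≤ ‖T‖ * ‖v‖ := by rw [one_mul]; gcongr
  refine ContinuousLinearMap.opNorm_le_bound _ (by positivity) fun v => ?_
  rw [rotOp_apply, Prod.norm_def, max_le_iff]
  have hc := Real.abs_cos_le_one θ
  have hs := Real.abs_sin_le_one θ
  constructor
  · refine (norm_sub_le _ _).trans ?_
    linarith [hb _ _ v hc (norm_fst_le v), hb _ _ v hs (norm_snd_le v)]
  · refine (norm_add_le _ _).trans ?_
    linarith [hb _ _ v hc (norm_snd_le v), hb _ _ v hs (norm_fst_le v)]

theorem rot_summable (ω : ℝ) {ψ : ℕ → H →L[ℝ] H} (hψ : Summable fun j => ‖ψ j‖) :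
    Summable fun j : ℕ => ‖rotOp (j * ω) (ContinuousLinearMap.adjoint (ψ j))‖ := by
  refine Summable.of_nonneg_of_le (fun j => norm_nonneg (rotOp (j * ω) (ContinuousLinearMap.adjoint (ψ j)))) (fun j => rotOp_norm _ _) ?_
  simpa using hψ.mul_left 2

theorem clm_cauchy {E : Type*} [NormedAddCommGroup E] [NormedSpace ℝ E] [CompleteSpace E]
    (f g : ℕ → E →L[ℝ] E) (hf : Summable fun j => ‖f j‖) (hg : Summable fun j => ‖g j‖) :
    (∑' n, f n) * (∑' n, g n) =
      ∑' n, ∑ p ∈ Finset.HasAntidiagonal.antidiagonal n, f p.1 * g p.2 :=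
  tsum_mul_tsum_eq_tsum_sum_antidiagonal_of_summable_norm hf hg

theorem rot_inv (ω : ℝ) {ψ P : ℕ → H →L[ℝ] H} (hψ : Summable fun j => ‖ψ j‖)
    (hP : Summable fun j => ‖P j‖)
    (h : ∀ n, ∑ p ∈ Finset.HasAntidiagonal.antidiagonal n, ψ p.1 * P p.2 = if n = 0 then 1 else 0) :
    (∑' j : ℕ, rotOp (j * ω) (ContinuousLinearMap.adjoint (P j))) *
      (∑' j : ℕ, rotOp (j * ω) (ContinuousLinearMap.adjoint (ψ j))) = 1 := by
  rw [clm_cauchy (E := H × H) (fun j : ℕ => rotOp (j * ω) (ContinuousLinearMap.adjoint (P j)))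
    (fun j : ℕ => rotOp (j * ω) (ContinuousLinearMap.adjoint (ψ j))) (rot_summable ω hP) (rot_summable ω hψ)]
  have : ∀ n : ℕ, (∑ p ∈ Finset.HasAntidiagonal.antidiagonal n,
      rotOp (p.1 * ω) (ContinuousLinearMap.adjoint (P p.1)) *
      rotOp (p.2 * ω) (ContinuousLinearMap.adjoint (ψ p.2))) = if n = 0 then 1 else 0 := by
    intro n
    have e : ∀ p ∈ Finset.HasAntidiagonal.antidiagonal n, rotOp (p.1 * ω) (ContinuousLinearMap.adjoint (P p.1)) *
      rotOp (p.2 * ω) (ContinuousLinearMap.adjoint (ψ p.2)) =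
      rotOp (n * ω) (ContinuousLinearMap.adjoint (ψ p.2 * P p.1)) := by
      intro p hp
      rw [Finset.HasAntidiagonal.mem_antidiagonal] at hp
      rw [rotOp_mul, ← add_mul, ← hp, Nat.cast_add]
      congr 1
      exact (ContinuousLinearMap.adjoint_comp _ _).symm
    rw [Finset.sum_congr rfl e, ← rotOp_sum, ← map_sum,
      ← Finset.Nat.sum_antidiagonal_swap (f := fun p => ψ p.2 * P p.1)]
    simp only [Prod.fst_swap, Prod.snd_swap]
    rw [h n]
    split_ifs with hn
    · refine ContinuousLinearMap.ext fun v => ?_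
      have h1 : ContinuousLinearMap.adjoint (1 : H →L[ℝ] H) = 1 :=
        ContinuousLinearMap.adjoint_id
      rw [rotOp_apply, h1]
      simp [hn]
    · refine ContinuousLinearMap.ext fun v => ?_
      simp [rotOp_apply]
  simp_rw [this]
  rw [tsum_ite_eq]

theorem extZ_comp (ψ : ℕ → H →L[ℝ] H) : (fun j : ℕ => extZ ψ (j : ℤ)) = ψ :=
  funext fun j => extZ_natCast ψ j

theorem extZ_of_not_range (ψ : ℕ → H →L[ℝ] H) (j : ℤ)
    (hj : j ∉ Set.range (Nat.cast : ℕ → ℤ)) : extZ ψ j = 0 := by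
  rw [extZ, if_neg]
  intro h
  exact hj ⟨j.toNat, Int.toNat_of_nonneg h⟩

theorem extZ_summable {ψ : ℕ → H →L[ℝ] H} (hψ : Summable fun j => ‖ψ j‖) :
    Summable fun j : ℤ => ‖extZ ψ j‖ := by
  rw [← (Nat.cast_injective (R := ℤ)).summable_iff]
  · simpa [Function.comp_def, extZ_natCast] using hψ
  · intro j hj
    rw [extZ_of_not_range ψ j hj, norm_zero]

/-- The terms `ψ_k C ψ_j^*`. -/
def Tm (ψ : ℕ → H →L[ℝ] H) (C : H →L[ℝ] H) (p : ℤ × ℕ) : H →L[ℝ] H :=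
  ψ p.2 ∘L C ∘L ContinuousLinearMap.adjoint (extZ ψ p.1)

theorem Tm_summable {ψ : ℕ → H →L[ℝ] H} (C : H →L[ℝ] H) (hψ : Summable fun j => ‖ψ j‖) :
    Summable fun p => ‖Tm ψ C p‖ := by
  have h1 := ((extZ_summable hψ).mul_of_nonneg hψ (fun _ => norm_nonneg _)
    (fun _ => norm_nonneg _)).mul_left ‖C‖
  refine Summable.of_nonneg_of_le (fun p => norm_nonneg _) (fun p => ?_) h1
  calc ‖Tm ψ C p‖ ≤ ‖ψ p.2‖ * (‖C‖ * ‖ContinuousLinearMap.adjoint (extZ ψ p.1)‖) :=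
        (ContinuousLinearMap.opNorm_comp_le _ _).trans
          (by gcongr; exact ContinuousLinearMap.opNorm_comp_le _ _)
    _ = ‖C‖ * (‖extZ ψ p.1‖ * ‖ψ p.2‖) := by
        rw [LinearIsometryEquiv.norm_map]; ring

theorem Tm_summable' {ψ : ℕ → H →L[ℝ] H} (C : H →L[ℝ] H) (hψ : Summable fun j => ‖ψ j‖)
    (c : ℤ → ℝ) (hc : ∀ h, |c h| ≤ 1) (x : H) :
    Summable fun p : ℤ × ℕ => c (p.2 - p.1) • Tm ψ C p x := by
  refine Summable.of_norm_bounded ((Tm_summable C hψ).mul_right ‖x‖) fun p => ?_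
  rw [norm_smul, Real.norm_eq_abs]
  calc |c (p.2 - p.1)| * ‖Tm ψ C p x‖ ≤ 1 * (‖Tm ψ C p‖ * ‖x‖) := by
        gcongr
        · exact hc _
        · exact ContinuousLinearMap.le_opNorm _ _
    _ = _ := one_mul _

/-- Reindexing by the lag. -/
def lagEquiv : ℤ × ℕ ≃ ℤ × ℕ where
  toFun p := (p.2 - p.1, p.2)
  invFun p := (p.2 - p.1, p.2)
  left_inv p := by simp
  right_inv p := by simp

theorem Cov_hasSum {μ : Measure Ω} {X ε : ℤ → Ω → H} {ψ : ℕ → H →L[ℝ] H}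
    (hFLP : IsFLP μ X ε ψ) (hψ : Summable fun j => ‖ψ j‖) (h : ℤ) (x : H) :
    HasSum (fun k : ℕ => Tm ψ (covOp μ (ε 0)) (k - h, k) x) (crossCov μ (X 0) (X h) x) := by
  obtain ⟨hε, -, -, hC, hC0⟩ := hFLP.whiteNoise
  have hX := hFLP.memLp
  have hs : Summable (fun k : ℕ => Tm ψ (covOp μ (ε 0)) (k - h, k) x) := by
    have h1 := Tm_summable' (covOp μ (ε 0)) hψ (fun _ => 1) (by simp) x
    have h2 := (lagEquiv.summable_iff.2 h1).comp_injective
      (i := fun k : ℕ => (h, k)) (fun a b hab => by simpa using hab)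
    simpa [Function.comp_def, lagEquiv] using h2
  have e : ∑' k : ℕ, Tm ψ (covOp μ (ε 0)) (k - h, k) x = crossCov μ (X 0) (X h) x := by
    refine ext_inner_left ℝ fun y => ?_
    have h3 := (hs.hasSum.mapL (innerSL ℝ y)).tendsto_sum_nat
    simp only [innerSL_apply_apply] at h3
    have h1 := crossCov_tendsto (fun _ => hX 0) (hX 0)
      (fun N => memLp_sum (fun j : ℕ => hε (h - j)) ψ N) (hX h)
      (tendsto_const_L2 _) (hFLP.repr h) x y
    rw [real_inner_comm y] at h1
    refine tendsto_nhds_unique h3 (h1.congr fun N => ?_)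
    rw [crossCov_sum_right (hX 0) (fun j : ℕ => hε (h - j))]
    refine Finset.sum_congr rfl fun k _ => ?_
    rw [← ContinuousLinearMap.adjoint_inner_right, crossCov_symm (hX 0) (hε _),
      crossCov_eps_X hFLP, ← ContinuousLinearMap.adjoint_inner_right, C_symm (hε 0),
      ContinuousLinearMap.adjoint_inner_left]
    have : (0 : ℤ) - (h - k) = k - h := by ring
    rw [this]
    rfl
  rw [← e]
  exact hs.hasSum

theorem lag_hasSum {μ : Measure Ω} {X ε : ℤ → Ω → H} {ψ : ℕ → H →L[ℝ] H}
    (hFLP : IsFLP μ X ε ψ) (hψ : Summable fun j => ‖ψ j‖)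
    (c : ℤ → ℝ) (hc : ∀ h, |c h| ≤ 1) (x : H) :
    HasSum (fun h : ℤ => c h • crossCov μ (X 0) (X h) x)
      (∑' p : ℤ × ℕ, c (p.2 - p.1) • Tm ψ (covOp μ (ε 0)) p x) := by
  have h1 := lagEquiv.hasSum_iff.2 (Tm_summable' (covOp μ (ε 0)) hψ c hc x).hasSum
  refine h1.prod_fiberwise fun h => ?_
  have := (Cov_hasSum hFLP hψ h x).const_smul (c h)
  simpa [Function.comp_def, lagEquiv] using this

theorem double_sum {C : H →L[ℝ] H} {ι κ : Type*} {u u' : ι → H} {v v' : κ → H} {a a' b b' : H}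
    (s : ℝ) (hu : HasSum u a) (hu' : HasSum u' a') (hv : HasSum v b) (hv' : HasSum v' b') {S : ℝ}
    (h : HasSum (fun p : ι × κ => ⟪C (u p.1), v p.2⟫ + s * ⟪C (u' p.1), v' p.2⟫) S) :
    S = ⟪C a, b⟫ + s * ⟪C a', b'⟫ := by
  have h1 := h.prod_fiberwise (g := fun i => ⟪C (u i), b⟫ + s * ⟪C (u' i), b'⟫) fun i => by
    simpa using (hv.mapL (innerSL ℝ (C (u i)))).add
      ((hv'.mapL (innerSL ℝ (C (u' i)))).mul_left s)
  have h2 : HasSum (fun i => ⟪C (u i), b⟫ + s * ⟪C (u' i), b'⟫) (⟪C a, b⟫ + s * ⟪C a', b'⟫) := by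
    have := ((hu.mapL C).mapL (innerSL ℝ b)).add
      (((hu'.mapL C).mapL (innerSL ℝ b')).mul_left s)
    simpa [real_inner_comm] using this
  exact h1.unique h2

theorem hasSum_of_eq {ι E : Type*} [AddCommMonoid E] [TopologicalSpace E] {f g : ι → E} {a : E}
    (h : HasSum f a) (hfg : ∀ i, f i = g i) : HasSum g a := by
  rwa [← funext hfg]

theorem clm_hasSum_apply {E : Type*} [NormedAddCommGroup E] [NormedSpace ℝ E] [CompleteSpace E]
    (f : ℕ → E →L[ℝ] E) (hf : Summable fun j => ‖f j‖) (v : E) :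
    HasSum (fun j => f j v) ((∑' j, f j) v) :=
  hf.of_norm.hasSum.mapL (ContinuousLinearMap.apply ℝ E v)

theorem rot_vec (ω : ℝ) {ψ P : ℕ → H →L[ℝ] H} (hψ : Summable fun j => ‖ψ j‖)
    (hP : Summable fun j => ‖P j‖)
    (h : ∀ n, ∑ p ∈ Finset.HasAntidiagonal.antidiagonal n, ψ p.1 * P p.2 = if n = 0 then 1 else 0)
    (x y : H) (hxy : ¬(x = 0 ∧ y = 0)) :
    ∃ w : H × H, HasSum (fun j : ℕ => rotOp (j * ω) (ContinuousLinearMap.adjoint (ψ j)) (x, y)) w ∧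
      w ≠ 0 := by
  have hI := rot_inv ω hψ hP h
  refine ⟨_, clm_hasSum_apply (E := H × H)
    (fun j : ℕ => rotOp (j * ω) (ContinuousLinearMap.adjoint (ψ j)))
    (rot_summable ω hψ) (x, y), ?_⟩
  intro h0
  have := congrArg (fun T : (H × H) →L[ℝ] (H × H) => T (x, y)) hI
  simp only [_root_.mul_apply_eq_comp] at this
  rw [h0, map_zero] at this
  have h2 : (0 : H × H) = (x, y) := this
  rw [Prod.ext_iff] at h2
  exact hxy ⟨h2.1.symm, h2.2.symm⟩

set_option maxHeartbeats 1000000 in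
theorem main_aux {μ : Measure Ω} {X ε : ℤ → Ω → H} {ψ piOp : ℕ → H →L[ℝ] H}
    (hFLP : IsFLP μ X ε ψ) (hinv : IsInvertible μ X ε piOp)
    (hψ : Summable fun j => ‖ψ j‖)
    (hCε : ∀ (c : ℝ) (v : H), v ≠ 0 → covOp μ (ε 0) v = c • v → 0 < c)
    (ω : ℝ) (x y : H) (hxy : ¬(x = 0 ∧ y = 0)) :
    0 < ⟪specRe μ X ω x y, x⟫ + ⟪specIm μ X ω x y, y⟫ ∧
    ⟪specIm μ X ω x y, x⟫ - ⟪specRe μ X ω x y, y⟫ = 0 := by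
  have hε := hFLP.whiteNoise.1
  set C := covOp μ (ε 0) with hC
  have hCs : ∀ x y, ⟪C x, y⟫ = ⟪x, C y⟫ := C_symm (hε 0)
  have hCp : ∀ v, v ≠ 0 → 0 < ⟪C v, v⟫ := C_pos (hε 0) hCε
  -- the vector `w = A* v`
  have hP : Summable fun j => ‖invCoef piOp j‖ := by
    rw [← summable_nat_add_iff 1]
    simpa [invCoef] using hinv.1
  obtain ⟨w, hwsum, hw0⟩ := rot_vec ω hψ hP
    (right_inv hFLP.psi_zero (recursion hFLP hinv hCε)) x y hxy
  set U : ℤ → H := fun j => Real.cos (j * ω) • ContinuousLinearMap.adjoint (extZ ψ j) x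
    - Real.sin (j * ω) • ContinuousLinearMap.adjoint (extZ ψ j) y with hU
  set V : ℤ → H := fun j => Real.cos (j * ω) • ContinuousLinearMap.adjoint (extZ ψ j) y
    + Real.sin (j * ω) • ContinuousLinearMap.adjoint (extZ ψ j) x with hV
  have hsumN : HasSum (fun j : ℕ => (U j, V j)) w := by
    refine hasSum_of_eq hwsum fun j => ?_
    simp only [rotOp_apply, hU, hV, extZ_natCast, Int.cast_natCast]
  have hu : HasSum (fun j : ℕ => U j) w.1 := hsumN.mapL (ContinuousLinearMap.fst ℝ H H)
  have hv : HasSum (fun j : ℕ => V j) w.2 := hsumN.mapL (ContinuousLinearMap.snd ℝ H H)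
  have hUZ : HasSum U w.1 := by
    refine ((Nat.cast_injective (R := ℤ)).hasSum_iff ?_).1 hu
    intro j hj
    simp [hU, extZ_of_not_range ψ j hj]
  have hVZ : HasSum V w.2 := by
    refine ((Nat.cast_injective (R := ℤ)).hasSum_iff ?_).1 hv
    intro j hj
    simp [hV, extZ_of_not_range ψ j hj]
  -- the spectral sums
  have hcos : ∀ h : ℤ, |Real.cos (h * ω)| ≤ 1 := fun h => Real.abs_cos_le_one _
  have hsin : ∀ h : ℤ, |Real.sin (h * ω)| ≤ 1 := fun h => Real.abs_sin_le_one _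
  have tc := fun z => (Tm_summable' C hψ (fun h => Real.cos (h * ω)) hcos z).hasSum
  have ts := fun z => (Tm_summable' C hψ (fun h => Real.sin (h * ω)) hsin z).hasSum
  have lc := fun z => lag_hasSum hFLP hψ (fun h => Real.cos (h * ω)) hcos z
  have ls := fun z => lag_hasSum hFLP hψ (fun h => Real.sin (h * ω)) hsin z
  have hRe : specRe μ X ω x y = (1 / (2 * Real.pi)) • _ :=
    congrArg (fun z : H => (1 / (2 * Real.pi)) • z) ((lc x).add (ls y)).tsum_eq
  have hIm : specIm μ X ω x y = (1 / (2 * Real.pi)) • _ :=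
    congrArg (fun z : H => (1 / (2 * Real.pi)) • z) ((lc y).sub (ls x)).tsum_eq
  have sRe := (tc x).add (ts y)
  have sIm := (tc y).sub (ts x)
  rw [← hC] at hRe hIm
  set SR := (∑' p : ℤ × ℕ, Real.cos (((p.2 - p.1 : ℤ) : ℝ) * ω) • Tm ψ C p x) +
    ∑' p : ℤ × ℕ, Real.sin (((p.2 - p.1 : ℤ) : ℝ) * ω) • Tm ψ C p y with hSR
  set SI := (∑' p : ℤ × ℕ, Real.cos (((p.2 - p.1 : ℤ) : ℝ) * ω) • Tm ψ C p y) -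
    ∑' p : ℤ × ℕ, Real.sin (((p.2 - p.1 : ℤ) : ℝ) * ω) • Tm ψ C p x with hSI
  have hT : ∀ (p : ℤ × ℕ) (a b : H), ⟪Tm ψ C p a, b⟫ =
      ⟪C (ContinuousLinearMap.adjoint (extZ ψ p.1) a),
        ContinuousLinearMap.adjoint (extZ ψ p.2) b⟫ := by
    intro p a b
    rw [extZ_natCast, ContinuousLinearMap.adjoint_inner_right]
    rfl
  have k1 : ⟪x, SR⟫ + ⟪y, SI⟫ = ⟪C w.1, w.1⟫ + 1 * ⟪C w.2, w.2⟫ := by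
    refine double_sum (C := C) 1 hUZ hVZ hu hv ?_
    have := (sRe.mapL (innerSL ℝ x)).add (sIm.mapL (innerSL ℝ y))
    refine hasSum_of_eq this fun p => ?_
    simp only [innerSL_apply_apply, real_inner_comm _ x, real_inner_comm _ y]
    simp only [inner_add_left, inner_sub_left, inner_smul_left, hT, hU, hV, map_add, map_sub,
      map_smul, inner_add_right, inner_sub_right, inner_smul_right, Int.cast_sub, sub_mul,
      Real.cos_sub, Real.sin_sub, Int.cast_natCast, RCLike.conj_to_real]
    ring
  have k2 : ⟪x, SI⟫ - ⟪y, SR⟫ = ⟪C w.2, w.1⟫ + (-1) * ⟪C w.1, w.2⟫ := by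
    refine double_sum (C := C) (-1) hVZ hUZ hu hv ?_
    have := (sIm.mapL (innerSL ℝ x)).sub (sRe.mapL (innerSL ℝ y))
    refine hasSum_of_eq this fun p => ?_
    simp only [innerSL_apply_apply, real_inner_comm _ x, real_inner_comm _ y]
    simp only [inner_add_left, inner_sub_left, inner_smul_left, hT, hU, hV, map_add, map_sub,
      map_smul, inner_add_right, inner_sub_right, inner_smul_right, Int.cast_sub, sub_mul,
      Real.cos_sub, Real.sin_sub, Int.cast_natCast, RCLike.conj_to_real]
    ring
  have hpi : 0 < 1 / (2 * Real.pi) := by positivity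
  have hnn : ∀ v, 0 ≤ ⟪C v, v⟫ := by
    intro v
    by_cases hv : v = 0
    · simp [hv]
    · exact (hCp v hv).le
  rw [hRe, hIm]
  simp only [real_inner_comm x, real_inner_comm y, real_inner_smul_right]
  constructor
  · rw [← mul_add, k1]
    refine mul_pos hpi ?_
    by_cases h1 : w.1 = 0
    · have h2 : w.2 ≠ 0 := fun h2 => hw0 (Prod.ext h1 h2)
      linarith [hnn w.1, hCp _ h2]
    · linarith [hnn w.2, hCp _ h1]
  · rw [← mul_sub, k2, hCs w.1, real_inner_comm w.1]
    ring

/-- For a stationary, invertible functional linear process with all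
eigenvalues of `C_ε` positive and `Σ_j ‖ψ_j‖_L < ∞`, the spectral density operator
`F_X[ω]` has only positive eigenvalues for every `ω ∈ (−π,π]`; in particular
`F_X[ω](v) ≠ 0` for every nonzero `v` in the complexification of `H`.
(A complex eigenvalue `c = a + ib` with eigenvector `v = x + iy` satisfies
`F_X[ω]v = cv`, i.e. the two displayed equations below; positivity means `b = 0`, `0 < a`.) -/
theorem spectral_density_positive_eigenvalues
    {Ω : Type*} [MeasurableSpace Ω] {H : Type*}
    [NormedAddCommGroup H] [InnerProductSpace ℝ H] [CompleteSpace H]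
    (μ : Measure Ω) [IsProbabilityMeasure μ]
    (X ε : ℤ → Ω → H) (ψ piOp : ℕ → H →L[ℝ] H)
    (hFLP : IsFLP μ X ε ψ) (hinv : IsInvertible μ X ε piOp)
    (hψ : Summable fun j => ‖ψ j‖)
    (hCε : ∀ (c : ℝ) (v : H), v ≠ 0 → covOp μ (ε 0) v = c • v → 0 < c) :
    ∀ ω ∈ Set.Ioc (-Real.pi) Real.pi,
      (∀ (a b : ℝ) (x y : H), ¬(x = 0 ∧ y = 0) →
        specRe μ X ω x y = a • x - b • y →
        specIm μ X ω x y = a • y + b • x →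
        b = 0 ∧ 0 < a) ∧
      (∀ x y : H, ¬(x = 0 ∧ y = 0) →
        ¬(specRe μ X ω x y = 0 ∧ specIm μ X ω x y = 0)) := by
  intro ω _
  have key := main_aux hFLP hinv hψ hCε ω
  have first : ∀ (a b : ℝ) (x y : H), ¬(x = 0 ∧ y = 0) →
        specRe μ X ω x y = a • x - b • y →
        specIm μ X ω x y = a • y + b • x →
        b = 0 ∧ 0 < a := by
    intro a b x y hxy h1 h2
    obtain ⟨k1, k2⟩ := key x y hxy
    rw [h1, h2] at k1 k2
    simp only [inner_add_left, inner_sub_left, real_inner_smul_left,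
      real_inner_self_eq_norm_sq, real_inner_comm x y] at k1 k2
    have hn : 0 < ‖x‖ ^ 2 + ‖y‖ ^ 2 := by
      by_cases hx : x = 0
      · have hy : y ≠ 0 := fun hy => hxy ⟨hx, hy⟩
        have := norm_pos_iff.2 hy
        positivity
      · have := norm_pos_iff.2 hx
        positivity
    constructor
    · have : b * (‖x‖ ^ 2 + ‖y‖ ^ 2) = 0 := by linarith
      exact (mul_eq_zero.1 this).resolve_right hn.ne'
    · have : 0 < a * (‖x‖ ^ 2 + ‖y‖ ^ 2) := by linarith
      exact pos_of_mul_pos_left this hn.le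
  refine ⟨first, fun x y hxy h => ?_⟩
  have := (first 0 0 x y hxy (by simp [h.1]) (by simp [h.2])).2
  exact lt_irrefl _ this


end FLP
end
end

section
/- Let (X_n)_{n∈ℤ} be a stationary, invertible functional linear process in L²_H with white noise (ε_n)_{n∈ℤ} such that all eigenvalues of C_ε are positive, with moving average coefficients (ψ_j)_{j≥0} (ψ_0 = I_H) and inverse representation coefficients (π_j)_{j≥1}. Then the coefficient operators satisfy the identity ψ_k = Σ_{j=1}^{k} π_j ψ_{k−j} for every k ≥ 1; equivalently, setting π_0 = −I_H, Σ_{j=0}^{k} π_j ψ_{k−j} = 0 for all k > 0. -/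
open MeasureTheory Filter
open scoped RealInnerProductSpace Topology

noncomputable section

namespace FLP

variable {Ω : Type*} [MeasurableSpace Ω]
variable {H : Type*} [NormedAddCommGroup H] [InnerProductSpace ℝ H] [CompleteSpace H]

theorem aux_norm_integral_le {Ω : Type*} [MeasurableSpace Ω] {H : Type*}
    [NormedAddCommGroup H] [InnerProductSpace ℝ H]
    (μ : Measure Ω) (f : Ω → ℝ) (g : Ω → H) (hf : MemLp f 2 μ) (hg : MemLp g 2 μ) :
    ‖∫ ω, f ω • g ω ∂μ‖ ≤ Real.sqrt (∫ ω, ‖f ω‖ ^ 2 ∂μ) * Real.sqrt (∫ ω, ‖g ω‖ ^ 2 ∂μ) := by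
  have h1 : ‖∫ ω, f ω • g ω ∂μ‖ ≤ ∫ ω, ‖f ω‖ * ‖g ω‖ ∂μ := by
    refine (norm_integral_le_integral_norm _).trans (le_of_eq ?_)
    simp only [norm_smul]
  refine h1.trans ?_
  have h2 : (2 : ℝ).HolderConjugate 2 := Real.HolderConjugate.two_two
  have := integral_mul_le_Lp_mul_Lq_of_nonneg (μ := μ) h2 (f := fun ω => ‖f ω‖)
    (g := fun ω => ‖g ω‖) (ae_of_all _ fun _ => norm_nonneg _)
    (ae_of_all _ fun _ => norm_nonneg _) (by simpa using hf.norm) (by simpa using hg.norm)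
  simpa [Real.sqrt_eq_rpow] using this

theorem aux_integrable_smul {Ω : Type*} [MeasurableSpace Ω] {H : Type*}
    [NormedAddCommGroup H] [InnerProductSpace ℝ H]
    (μ : Measure Ω) (f : Ω → ℝ) (g : Ω → H) (hf : MemLp f 2 μ) (hg : MemLp g 2 μ) :
    Integrable (fun ω => f ω • g ω) μ := by
  have := MemLp.smul (p := 2) (q := 2) (r := 1) hg hf
  exact memLp_one_iff_integrable.1 this

theorem aux_lim {Ω : Type*} [MeasurableSpace Ω] {H : Type*}
    [NormedAddCommGroup H] [InnerProductSpace ℝ H]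
    (μ : Measure Ω) (f : Ω → ℝ) (W : Ω → H) (Y : ℕ → Ω → H) (hf : MemLp f 2 μ)
    (hW : MemLp W 2 μ) (hY : ∀ j, MemLp (Y j) 2 μ) (K : ℕ)
    (hK : ∀ j, K ≤ j → ∫ ω, f ω • Y j ω ∂μ = 0)
    (hlim : Tendsto (fun N : ℕ => ∫ ω, ‖W ω - ∑ j ∈ Finset.range N, Y j ω‖ ^ 2 ∂μ)
      atTop (𝓝 0)) :
    ∫ ω, f ω • W ω ∂μ = ∑ j ∈ Finset.range K, ∫ ω, f ω • Y j ω ∂μ := by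
  have hint : ∀ N : ℕ, ∫ ω, f ω • (W ω - ∑ j ∈ Finset.range N, Y j ω) ∂μ
      = ∫ ω, f ω • W ω ∂μ - ∑ j ∈ Finset.range N, ∫ ω, f ω • Y j ω ∂μ := by
    intro N
    simp only [smul_sub, Finset.smul_sum]
    rw [integral_sub (aux_integrable_smul μ f W hf hW)
      (integrable_finsetSum _ fun j _ => aux_integrable_smul μ f _ hf (hY j)),
      integral_finsetSum _ fun j _ => aux_integrable_smul μ f _ hf (hY j)]
  have hle : ∀ N : ℕ, ‖∫ ω, f ω • (W ω - ∑ j ∈ Finset.range N, Y j ω) ∂μ‖ ≤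
      Real.sqrt (∫ ω, ‖f ω‖ ^ 2 ∂μ) *
        Real.sqrt (∫ ω, ‖W ω - ∑ j ∈ Finset.range N, Y j ω‖ ^ 2 ∂μ) := fun N =>
    aux_norm_integral_le μ f _ hf (hW.sub (memLp_finsetSum _ fun j _ => hY j))
  have hto : Tendsto (fun N : ℕ => ∫ ω, f ω • (W ω - ∑ j ∈ Finset.range N, Y j ω) ∂μ)
      atTop (𝓝 0) := by
    refine squeeze_zero_norm hle ?_
    have := (Real.continuous_sqrt.tendsto 0).comp hlim
    have h3 := this.const_mul (Real.sqrt (∫ ω, ‖f ω‖ ^ 2 ∂μ))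
    rw [Real.sqrt_zero, mul_zero] at h3
    exact h3
  have hev : ∀ᶠ N : ℕ in atTop, ∫ ω, f ω • (W ω - ∑ j ∈ Finset.range N, Y j ω) ∂μ
      = ∫ ω, f ω • W ω ∂μ - ∑ j ∈ Finset.range K, ∫ ω, f ω • Y j ω ∂μ := by
    filter_upwards [eventually_ge_atTop K] with N hN
    rw [hint N]
    congr 1
    symm
    refine Finset.sum_subset (Finset.range_subset_range.2 hN) ?_
    intro j _ hj
    exact hK j (by simpa using hj)
  have := tendsto_nhds_unique (hto.congr' hev) tendsto_const_nhds
  exact (sub_eq_zero.1 this.symm)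

theorem aux_crossCov_apply {Ω : Type*} [MeasurableSpace Ω] {H : Type*}
    [NormedAddCommGroup H] [InnerProductSpace ℝ H] [CompleteSpace H]
    (μ : Measure Ω) (X Y : Ω → H) (hX : MemLp X 2 μ) (hY : MemLp Y 2 μ) (v : H) :
    crossCov μ X Y v = ∫ ω, ⟪X ω, v⟫ • Y ω ∂μ := by
  have hc : Continuous fun p : H × H => outer p.1 p.2 := by
    have : (fun p : H × H => outer p.1 p.2) =
        fun p : H × H => ContinuousLinearMap.smulRightL ℝ H H (innerSL ℝ p.1) p.2 := by
      ext p z; simp [outer]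
    rw [this]
    fun_prop
  have hint : Integrable (fun ω => outer (X ω) (Y ω)) μ := by
    have h1 : Integrable (fun ω => ‖X ω‖ * ‖Y ω‖) μ := hX.norm.integrable_mul hY.norm
    refine h1.mono' (hc.comp_aestronglyMeasurable
      (hX.aestronglyMeasurable.prodMk hY.aestronglyMeasurable)) (ae_of_all _ fun ω => ?_)
    simp [outer]
  rw [crossCov, ContinuousLinearMap.integral_apply hint]
  simp [outer]

theorem aux_comm {Ω : Type*} [MeasurableSpace Ω] {H : Type*}
    [NormedAddCommGroup H] [InnerProductSpace ℝ H] [CompleteSpace H]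
    (μ : Measure Ω) (f : Ω → ℝ) (Y : Ω → H) (T : H →L[ℝ] H)
    (hf : MemLp f 2 μ) (hY : MemLp Y 2 μ) :
    ∫ ω, f ω • T (Y ω) ∂μ = T (∫ ω, f ω • Y ω ∂μ) := by
  rw [← ContinuousLinearMap.integral_comp_comm T (aux_integrable_smul μ f Y hf hY)]
  simp

theorem aux_dense {Ω : Type*} [MeasurableSpace Ω] {H : Type*}
    [NormedAddCommGroup H] [InnerProductSpace ℝ H] [CompleteSpace H]
    (μ : Measure Ω) (e : Ω → H) (he : MemLp e 2 μ)
    (hC : ∀ (c : ℝ) (v : H), v ≠ 0 → covOp μ e v = c • v → 0 < c) :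
    DenseRange (covOp μ e) := by
  have hin : ∀ v : H, MemLp (fun ω => ⟪e ω, v⟫) 2 μ := fun v => he.inner_const v
  have hsym : ∀ v w : H, ⟪covOp μ e v, w⟫ = ⟪covOp μ e w, v⟫ := by
    intro v w
    rw [covOp, aux_crossCov_apply μ e e he he, aux_crossCov_apply μ e e he he,
      real_inner_comm, real_inner_comm v,
      ← integral_inner (aux_integrable_smul μ _ e (hin v) he),
      ← integral_inner (aux_integrable_smul μ _ e (hin w) he)]
    refine integral_congr_ae (ae_of_all _ fun ω => ?_)
    simp only [inner_smul_right]
    rw [real_inner_comm (e ω) w, real_inner_comm (e ω) v, mul_comm]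
  have hd : (LinearMap.range (covOp μ e).toLinearMap).topologicalClosure = ⊤ := by
    rw [Submodule.topologicalClosure_eq_top_iff, Submodule.eq_bot_iff]
    intro w hw
    by_contra hne
    have h0 : covOp μ e w = (0 : ℝ) • w := by
      rw [zero_smul]
      refine ext_inner_right ℝ fun v => ?_
      rw [← hsym v w, inner_zero_left]
      exact (Submodule.mem_orthogonal _ _).1 hw _ ⟨v, rfl⟩
    exact lt_irrefl _ (hC 0 w hne h0)
  have := Submodule.dense_iff_topologicalClosure_eq_top.2 hd
  exact this

theorem aux_key {Ω : Type*} [MeasurableSpace Ω] {H : Type*}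
    [NormedAddCommGroup H] [InnerProductSpace ℝ H] [CompleteSpace H]
    (μ : Measure Ω)
    (X ε : ℤ → Ω → H) (ψ piOp : ℕ → H →L[ℝ] H)
    (hFLP : IsFLP μ X ε ψ) (hinv : IsInvertible μ X ε piOp)
    (hCε : ∀ (c : ℝ) (v : H), v ≠ 0 → covOp μ (ε 0) v = c • v → 0 < c)
    (k : ℕ) (hk : 1 ≤ k) :
    ψ k = ∑ j ∈ Finset.range k, piOp (j + 1) ∘L ψ (k - (j + 1)) := by
  obtain ⟨hε, -, -, -, hwn⟩ := hFLP.whiteNoise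
  have hX := hFLP.memLp
  have hin : ∀ v : H, MemLp (fun ω => ⟪ε 0 ω, v⟫) 2 μ := fun v => (hε 0).inner_const v
  have hz : ∀ (v : H) (n : ℤ), n ≠ 0 → ∫ ω, ⟪ε 0 ω, v⟫ • ε n ω ∂μ = 0 := by
    intro v n hn
    rw [← aux_crossCov_apply μ _ _ (hε 0) (hε n), hwn 0 n hn.symm]; simp
  have hψmem : ∀ (T : H →L[ℝ] H) (Y : Ω → H), MemLp Y 2 μ → MemLp (fun ω => T (Y ω)) 2 μ :=
    fun T Y hY => T.comp_memLp' hY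
  have hXneg : ∀ (v : H) (n : ℤ), n < 0 → ∫ ω, ⟪ε 0 ω, v⟫ • X n ω ∂μ = 0 := by
    intro v n hn
    have := aux_lim μ _ (X n) (fun j ω => ψ j (ε (n - j) ω)) (hin v) (hX n)
      (fun j => hψmem _ _ (hε _)) 0 ?_ (hFLP.repr n)
    · simpa using this
    · intro j _
      rw [aux_comm μ _ _ _ (hin v) (hε _), hz v _ (by omega), map_zero]
  have hXpos : ∀ (v : H) (n : ℕ), ∫ ω, ⟪ε 0 ω, v⟫ • X n ω ∂μ = ψ n (covOp μ (ε 0) v) := by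
    intro v n
    have := aux_lim μ _ (X n) (fun j ω => ψ j (ε (n - j) ω)) (hin v) (hX n)
      (fun j => hψmem _ _ (hε _)) (n + 1) ?_ (hFLP.repr n)
    · rw [this, Finset.sum_range_succ, Finset.sum_eq_zero, zero_add,
        aux_comm μ _ _ _ (hin v) (hε _), sub_self, covOp,
        aux_crossCov_apply μ _ _ (hε 0) (hε 0)]
      intro j hj
      have hj' := Finset.mem_range.1 hj
      rw [aux_comm μ _ _ _ (hin v) (hε _), hz v _ (by omega), map_zero]
    · intro j hj
      rw [aux_comm μ _ _ _ (hin v) (hε _), hz v _ (by omega), map_zero]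
  have hmain : ∀ v : H, ψ k (covOp μ (ε 0) v) =
      (∑ j ∈ Finset.range k, piOp (j + 1) ∘L ψ (k - (j + 1))) (covOp μ (ε 0) v) := by
    intro v
    have h := aux_lim μ _ (fun ω => X k ω - ε k ω)
      (fun j ω => piOp (j + 1) (X ((k : ℤ) - (j + 1)) ω)) (hin v) ((hX k).sub (hε k))
      (fun j => hψmem _ _ (hX _)) k ?_ (hinv.2 k)
    · simp only [smul_sub] at h
      rw [integral_sub (aux_integrable_smul μ _ _ (hin v) (hX _))
        (aux_integrable_smul μ _ _ (hin v) (hε _)), hz v k (by omega), sub_zero, hXpos] at h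
      rw [h, ContinuousLinearMap.sum_apply]
      refine Finset.sum_congr rfl fun j hj => ?_
      have hj' := Finset.mem_range.1 hj
      have e : (k : ℤ) - (j + 1) = ((k - (j + 1) : ℕ) : ℤ) := by omega
      rw [aux_comm μ _ _ _ (hin v) (hX _), e, hXpos]
      rfl
    · intro j hj
      rw [aux_comm μ _ _ _ (hin v) (hX _), hXneg v _ (by omega), map_zero]
  have hd := aux_dense μ (ε 0) (hε 0) hCε
  have := hd.equalizer (ψ k).continuous
    (∑ j ∈ Finset.range k, piOp (j + 1) ∘L ψ (k - (j + 1))).continuous (funext hmain)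
  exact DFunLike.coe_injective this

/-- For a stationary invertible functional linear process with moving
average coefficients `(ψ_j)` (with `ψ_0 = I_H`) and inverse representation coefficients
`(π_j)`, `ψ_k = Σ_{j=1}^k π_j ψ_{k−j}` for every `k ≥ 1`; equivalently, setting
`π_0 = −I_H`, `Σ_{j=0}^k π_j ψ_{k−j} = 0` for all `k > 0`. -/
theorem ma_and_ar_coefficients_identity
    {Ω : Type*} [MeasurableSpace Ω] {H : Type*}
    [NormedAddCommGroup H] [InnerProductSpace ℝ H] [CompleteSpace H]
    (μ : Measure Ω) [IsProbabilityMeasure μ]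
    (X ε : ℤ → Ω → H) (ψ piOp : ℕ → H →L[ℝ] H)
    (hFLP : IsFLP μ X ε ψ) (hinv : IsInvertible μ X ε piOp)
    (hCε : ∀ (c : ℝ) (v : H), v ≠ 0 → covOp μ (ε 0) v = c • v → 0 < c) :
    (∀ k : ℕ, 1 ≤ k → ψ k = ∑ j ∈ Finset.Icc 1 k, piOp j ∘L ψ (k - j)) ∧
    (∀ k : ℕ, 1 ≤ k →
      ∑ j ∈ Finset.range (k + 1),
        (if j = 0 then -ContinuousLinearMap.id ℝ H else piOp j) ∘L ψ (k - j) = 0) := by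
  have key := aux_key μ X ε ψ piOp hFLP hinv hCε
  refine ⟨fun k hk => ?_, fun k hk => ?_⟩
  · rw [key k hk, Finset.range_eq_Ico,
      Finset.sum_Ico_add' (fun j => piOp j ∘L ψ (k - j)) 0 k 1]
    rfl
  · rw [Finset.sum_range_succ']
    simp only [Nat.add_eq_zero_iff, one_ne_zero, and_false, if_false, if_true]
    rw [← key k hk]
    ext x
    simp

end FLP
end
end
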